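/- Let ⟨f0, f1⟩ be an MWG-drawing of a pair ⟨G0, G1⟩ of finite complete bipartite graphs, each having both color classes nonempty and each containing at least one pair of distinct non-adjacent vertices. Then each drawing is crossing-free: for each i ∈ {0,1} and any four distinct vertices a, b, a', b' of G_i such that ab and a'b' are edges of G_i, the closed segments [f_i(a), f_i(b)] and [f_i(a'), f_i(b')] are disjoint (hence each G_i admits a planar straight-line drawing). -/

import Mathlib

noncomputable section

/-- The Euclidean plane. -/
abbrev Pt : Type := EuclideanSpace ℝ (Fin 2)

/-- The Gabriel disk `D[u,v]`: the closed disk having `u` and `v` as antipodal points. -/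
def gabrielDisk (u v : Pt) : Set Pt := Metric.closedBall (midpoint ℝ u v) (dist u v / 2)

/-- `f` is a witness Gabriel drawing of the finite simple graph `G` with witness set `P`. -/
def IsWGDrawing {V : Type*} [Fintype V] (G : SimpleGraph V) (f : V → Pt) (P : Set Pt) : Prop :=
  Function.Injective f ∧ Disjoint (Set.range f) P ∧
    ∀ u v : V, u ≠ v → (G.Adj u v ↔ gabrielDisk (f u) (f v) ∩ P = ∅)

/-- `⟨f₀, f₁⟩` is a mutual witness Gabriel drawing of the pair `⟨G₀, G₁⟩`. -/
def IsMWGDrawing {V₀ V₁ : Type*} [Fintype V₀] [Fintype V₁]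
    (G₀ : SimpleGraph V₀) (G₁ : SimpleGraph V₁) (f₀ : V₀ → Pt) (f₁ : V₁ → Pt) : Prop :=
  Function.Injective f₀ ∧ Function.Injective f₁ ∧
    Disjoint (Set.range f₀) (Set.range f₁) ∧
    (∀ u v : V₀, u ≠ v → (G₀.Adj u v ↔ gabrielDisk (f₀ u) (f₀ v) ∩ Set.range f₁ = ∅)) ∧
    (∀ u v : V₁, u ≠ v → (G₁.Adj u v ↔ gabrielDisk (f₁ u) (f₁ v) ∩ Set.range f₀ = ∅))

/-- Two subsets of the plane are linearly separable. -/
def LinSep (A B : Set Pt) : Prop :=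
  ∃ (φ : Pt →ₗ[ℝ] ℝ) (c : ℝ), φ ≠ 0 ∧ (∀ a ∈ A, φ a < c) ∧ ∀ b ∈ B, c < φ b

/-- The inner product of `u - p` and `v - p`, in coordinates. -/
def dotAt (p u v : Pt) : ℝ := (u 0 - p 0) * (v 0 - p 0) + (u 1 - p 1) * (v 1 - p 1)

/-- The cross product of `u - p` and `v - p`, in coordinates. -/
def crossAt (p u v : Pt) : ℝ := (u 0 - p 0) * (v 1 - p 1) - (u 1 - p 1) * (v 0 - p 0)

theorem dotAt_comm (p u v : Pt) : dotAt p u v = dotAt p v u := by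
  unfold dotAt; ring

theorem crossAt_swap (p u v : Pt) : crossAt p u v = -crossAt p v u := by
  unfold crossAt; ring

theorem dotAt_self_nonneg (p u : Pt) : 0 ≤ dotAt p u u := by
  unfold dotAt; nlinarith [sq_nonneg (u 0 - p 0), sq_nonneg (u 1 - p 1)]

theorem dotAt_self_pos {p u : Pt} (h : p ≠ u) : 0 < dotAt p u u := by
  refine lt_of_le_of_ne (dotAt_self_nonneg p u) fun h0 => h ?_
  unfold dotAt at h0
  ext i
  fin_cases i
  · show p 0 = u 0
    nlinarith [sq_nonneg (u 0 - p 0), sq_nonneg (u 1 - p 1)]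
  · show p 1 = u 1
    nlinarith [sq_nonneg (u 0 - p 0), sq_nonneg (u 1 - p 1)]

theorem dotAt_self_pos_of_dotAt_pos {p u v : Pt} (h : 0 < dotAt p u v) : 0 < dotAt p u u := by
  refine dotAt_self_pos ?_
  rintro rfl
  simp [dotAt] at h

theorem mem_gabrielDisk_iff (p u v : Pt) : p ∈ gabrielDisk u v ↔ dotAt p u v ≤ 0 := by
  have h1 : dist p (midpoint ℝ u v) ^ 2 - (dist u v / 2) ^ 2 = dotAt p u v := by
    rw [div_pow, EuclideanSpace.dist_sq_eq, EuclideanSpace.dist_sq_eq]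
    simp only [Fin.sum_univ_two, Real.dist_eq, sq_abs, midpoint_eq_smul_add, PiLp.smul_apply,
      PiLp.add_apply, smul_eq_mul, invOf_eq_inv, dotAt]
    ring
  rw [gabrielDisk, Metric.mem_closedBall, ← h1, sub_nonpos]
  exact (pow_le_pow_iff_left₀ dist_nonneg (by positivity) two_ne_zero).symm

/-- A point on the line through two distinct points is an affine combination of them. -/
theorem exists_lineMap_of_crossAt_eq_zero {x0 x1 : ℝ} {a b : Pt} (hab : 0 < dotAt a b b)
    (h : (a 0 - x0) * (b 1 - x1) - (a 1 - x1) * (b 0 - x0) = 0) :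
    ∃ y : ℝ, x0 = a 0 + y * (b 0 - a 0) ∧ x1 = a 1 + y * (b 1 - a 1) := by
  refine ⟨((x0 - a 0) * (b 0 - a 0) + (x1 - a 1) * (b 1 - a 1)) / dotAt a b b, ?_, ?_⟩
  · field_simp
    unfold dotAt
    linear_combination (-(b 1 - a 1)) * h
  · field_simp
    unfold dotAt
    linear_combination (b 0 - a 0) * h

/-- Two crossing segments `ab` and `qr`: one of the four angles of the quadrilateral `aqbr`
is not acute. -/
theorem not_crossing_of_acute {a b q r : Pt} {y w : ℝ} (hy : 0 < y) (hy1 : y < 1) (hw : 0 ≤ w)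
    (hw1 : w ≤ 1)
    (h0 : q 0 + w * (r 0 - q 0) = a 0 + y * (b 0 - a 0))
    (h1 : q 1 + w * (r 1 - q 1) = a 1 + y * (b 1 - a 1))
    (hq : 0 < dotAt q a b) (hr : 0 < dotAt r a b)
    (ha : 0 < dotAt a q r) (hb : 0 < dotAt b q r) : False := by
  have key : (1 - w) * dotAt q a b + w * dotAt r a b + (1 - y) * dotAt a q r
      + y * dotAt b q r = 0 := by
    have e1 : (1 - w) * dotAt q a b + w * dotAt r a b - w * (1 - w) * dotAt q r r
        = (a 0 - (q 0 + w * (r 0 - q 0))) * (b 0 - (q 0 + w * (r 0 - q 0)))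
          + (a 1 - (q 1 + w * (r 1 - q 1))) * (b 1 - (q 1 + w * (r 1 - q 1))) := by
      unfold dotAt; ring
    have e2 : (1 - y) * dotAt a q r + y * dotAt b q r - y * (1 - y) * dotAt a b b
        = (q 0 - (a 0 + y * (b 0 - a 0))) * (r 0 - (a 0 + y * (b 0 - a 0)))
          + (q 1 - (a 1 + y * (b 1 - a 1))) * (r 1 - (a 1 + y * (b 1 - a 1))) := by
      unfold dotAt; ring
    rw [h0, h1] at e1
    rw [← h0, ← h1] at e2
    unfold dotAt at *
    linear_combination e1 + e2
  have := mul_nonneg (sub_nonneg.2 hw1) hq.le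
  have := mul_nonneg hw hr.le
  have := mul_pos (sub_pos.2 hy1) ha
  have := mul_pos hy hb
  linarith

/-- The segment `qr` cannot pass from one side of the line `ab` to the other when the angles of the
quadrilateral `aqbr` are acute and `r` projects into the segment `ab`. -/
theorem crossAt_mul_pos_of_acute {a b q r : Pt}
    (hq : 0 < dotAt q a b) (hr : 0 < dotAt r a b)
    (ha : 0 < dotAt a q r) (hb : 0 < dotAt b q r)
    (hra : 0 < dotAt a b r) (hrb : 0 < dotAt b a r) :
    0 < crossAt q a b * crossAt r a b := by
  have hab := dotAt_self_pos_of_dotAt_pos hra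
  have hr0 : crossAt r a b ≠ 0 := by
    intro h
    have : dotAt a b b * dotAt r a b = crossAt r a b ^ 2 - dotAt a b r * dotAt b a r := by
      unfold dotAt crossAt; ring
    rw [h] at this
    nlinarith [mul_pos hab hr, mul_pos hra hrb]
  by_contra hcon
  have hcon := not_lt.1 hcon
  have hne : crossAt q a b - crossAt r a b ≠ 0 := by
    intro h
    rw [sub_eq_zero.1 h] at hcon
    exact hr0 (mul_self_eq_zero.1 (le_antisymm hcon (mul_self_nonneg _)))
  obtain ⟨w, hw⟩ : ∃ w, w * (crossAt q a b - crossAt r a b) = crossAt q a b :=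
    ⟨_, div_mul_cancel₀ _ hne⟩
  have hpos : 0 < (crossAt q a b - crossAt r a b) ^ 2 := by positivity
  have hpos' : 0 < crossAt r a b ^ 2 := by positivity
  have hw0 : 0 ≤ w := by
    by_contra hneg
    nlinarith [mul_neg_of_neg_of_pos (not_le.1 hneg) hpos, sq_nonneg (crossAt q a b)]
  have hw1 : w < 1 := by
    by_contra hneg
    nlinarith [mul_nonneg (sub_nonneg.2 (not_lt.1 hneg)) hpos.le]
  have hline : (a 0 - (q 0 + w * (r 0 - q 0))) * (b 1 - (q 1 + w * (r 1 - q 1)))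
      - (a 1 - (q 1 + w * (r 1 - q 1))) * (b 0 - (q 0 + w * (r 0 - q 0))) = 0 := by
    unfold crossAt at hw
    linear_combination -hw
  obtain ⟨y, h0, h1⟩ := exists_lineMap_of_crossAt_eq_zero hab hline
  have ea : y * dotAt a b r = (1 - w) * dotAt a q r + w * dotAt a r r := by
    unfold dotAt
    linear_combination (-(r 0 - a 0)) * h0 - (r 1 - a 1) * h1
  have eb : (1 - y) * dotAt b a r = (1 - w) * dotAt b q r + w * dotAt b r r := by
    unfold dotAt
    linear_combination (-(r 0 - b 0)) * h0 - (r 1 - b 1) * h1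
  have hw1' := sub_pos.2 hw1
  have hy : 0 < y := by
    have : 0 < y * dotAt a b r := by
      rw [ea]; have := mul_nonneg hw0 (dotAt_self_nonneg a r); positivity
    exact pos_of_mul_pos_left this hra.le
  have hy1 : 0 < 1 - y := by
    have : 0 < (1 - y) * dotAt b a r := by
      rw [eb]; have := mul_nonneg hw0 (dotAt_self_nonneg b r); positivity
    exact pos_of_mul_pos_left this hrb.le
  exact not_crossing_of_acute hy (by linarith) hw0 hw1.le h0 h1 hq hr ha hb

/-- If `r` is a common neighbour of `q` and `q'` (or `r = q'`), then the edge `ab` does not meet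
the segment `qq'`. -/
theorem edge_not_meet_segment {a b q q' r : Pt} {τ ρ : ℝ} (hτ : 0 ≤ τ) (hτ1 : τ ≤ 1)
    (hρ : 0 ≤ ρ) (hρ1 : ρ ≤ 1)
    (h0 : q 0 + τ * (q' 0 - q 0) = a 0 + ρ * (b 0 - a 0))
    (h1 : q 1 + τ * (q' 1 - q 1) = a 1 + ρ * (b 1 - a 1))
    (hq : 0 < dotAt q a b) (hq' : 0 < dotAt q' a b) (hr : 0 < dotAt r a b)
    (ha : 0 < dotAt a q r) (ha' : 0 < dotAt a q' r)
    (hb : 0 < dotAt b q r) (hb' : 0 < dotAt b q' r) : False := by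
  have ea : ρ * dotAt a b r = (1 - τ) * dotAt a q r + τ * dotAt a q' r := by
    unfold dotAt
    linear_combination (-(r 0 - a 0)) * h0 - (r 1 - a 1) * h1
  have eb : (1 - ρ) * dotAt b a r = (1 - τ) * dotAt b q r + τ * dotAt b q' r := by
    unfold dotAt
    linear_combination (-(r 0 - b 0)) * h0 - (r 1 - b 1) * h1
  have comb : ∀ x y : ℝ, 0 < x → 0 < y → 0 < (1 - τ) * x + τ * y := by
    intro x y hx hy
    rcases eq_or_lt_of_le hτ with h | h
    · subst h; simpa using hx
    · have := mul_nonneg (sub_nonneg.2 hτ1) hx.le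
      have := mul_pos h hy
      linarith
  have hra : 0 < dotAt a b r := pos_of_mul_pos_right (ea ▸ comb _ _ ha ha') hρ
  have hrb : 0 < dotAt b a r :=
    pos_of_mul_pos_right (eb ▸ comb _ _ hb hb') (sub_nonneg.2 hρ1)
  have k := crossAt_mul_pos_of_acute hq hr ha hb hra hrb
  have k' := crossAt_mul_pos_of_acute hq' hr ha' hb' hra hrb
  have hz : (1 - τ) * crossAt q a b + τ * crossAt q' a b = 0 := by
    unfold crossAt
    linear_combination (a 1 - b 1) * h0 - (a 0 - b 0) * h1
  have := comb _ _ k k'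
  have e : (1 - τ) * (crossAt q a b * crossAt r a b) + τ * (crossAt q' a b * crossAt r a b)
      = 0 := by linear_combination crossAt r a b * hz
  linarith

/-- If `a`, `a'` are seen from `q` at a non-acute angle while `a`, `b` and `a'`, `b` are seen at
acute angles, then `b` and `a'` lie on the same side of the line `qa`. -/
theorem crossAt_mul_crossAt_pos {q a a' b : Pt} (h : dotAt q a a' ≤ 0) (hab : 0 < dotAt q a b)
    (hab' : 0 < dotAt q a' b) : 0 < crossAt q a a' * crossAt q a b := by
  have e : crossAt q a a' * crossAt q a b
      = dotAt q a a * dotAt q a' b - dotAt q a b * dotAt q a a' := by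
    unfold dotAt crossAt; ring
  have := mul_pos (dotAt_self_pos_of_dotAt_pos hab) hab'
  nlinarith [mul_nonneg hab.le (neg_nonneg.2 h)]

theorem dotAt_pos_of_crossAt {q a b b' : Pt} (hb : 0 < dotAt q a b) (hb' : 0 < dotAt q a b')
    (h : 0 < crossAt q a b * crossAt q a b') : 0 < dotAt q b b' := by
  have e : dotAt q a a * dotAt q b b'
      = crossAt q a b * crossAt q a b' + dotAt q a b * dotAt q a b' := by
    unfold dotAt crossAt; ring
  exact pos_of_mul_pos_right (e ▸ add_pos h (mul_pos hb hb')) (dotAt_self_nonneg q a)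

/-- The triangle `qaa'` lies in the Gabriel disk of `a`, `a'` when `q` does. -/
theorem not_mem_triangle {q q' a a' : Pt} (h : dotAt q a a' ≤ 0) (h' : 0 < dotAt q' a a')
    (hpos : 0 < crossAt q a a') (h1 : 0 ≤ crossAt q' a a') (h2 : 0 ≤ crossAt q a q')
    (h3 : 0 ≤ crossAt q q' a') : False := by
  have hs : crossAt q' a a' + crossAt q a q' + crossAt q q' a' = crossAt q a a' := by
    unfold crossAt; ring
  have e : crossAt q a a' ^ 2 * dotAt q' a a'
      = crossAt q a a' * crossAt q' a a' * dotAt q a a'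
        - (crossAt q q' a' * crossAt q' a a' * dotAt q a a
          + crossAt q a q' * crossAt q' a a' * dotAt q a' a'
          + crossAt q q' a' * crossAt q a q' * dotAt a a' a') := by
    unfold crossAt dotAt; ring
  have := mul_pos (pow_pos hpos 2) h'
  have := mul_nonneg (mul_nonneg hpos.le h1) (neg_nonneg.2 h)
  have := mul_nonneg (mul_nonneg h3 h1) (dotAt_self_nonneg q a)
  have := mul_nonneg (mul_nonneg h2 h1) (dotAt_self_nonneg q a')
  have := mul_nonneg (mul_nonneg h3 h2) (dotAt_self_nonneg a a')
  linarith

theorem same_side_false {P P' R R' m n k l : ℝ} (hP : 0 < P) (hP' : 0 < P') (hR : 0 < R)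
    (hR' : 0 < R') (hm : 0 < m) (hn : 0 < n) (hk : 0 < k) (hl : 0 < l)
    (h1 : n * R < m * P) (h2 : m * P' < n * R')
    (h3 : k * P < l * R) (h4 : l * R' < k * P') : False := by
  have a1 : n * R * (m * P') < m * P * (n * R') :=
    mul_lt_mul'' h1 h2 (by positivity) (by positivity)
  have a2 : k * P * (l * R') < l * R * (k * P') :=
    mul_lt_mul'' h3 h4 (by positivity) (by positivity)
  have b1 : R * P' < P * R' := by
    have : m * n * (R * P') < m * n * (P * R') := by linarith
    exact lt_of_mul_lt_mul_left this (by positivity)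
  have b2 : P * R' < R * P' := by
    have : k * l * (P * R') < k * l * (R * P') := by linarith
    exact lt_of_mul_lt_mul_left this (by positivity)
  linarith

/-- Two crossing segments `ab`, `a'b'` cannot be such that `q` sees `a`, `a'` as the extreme points
at a non-acute angle, `q'` sees `b'`, `b` so, and the lines `ab'`, `a'b` separate `q` from `q'`. -/
theorem crossing_false_of_lines_separate {a b a' b' q q' : Pt} {s t : ℝ}
    (hs : 0 ≤ s) (hs1 : s ≤ 1) (ht : 0 ≤ t) (ht1 : t ≤ 1)
    (h0 : (1 - s) * a 0 + s * b 0 = (1 - t) * a' 0 + t * b' 0)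
    (h1 : (1 - s) * a 1 + s * b 1 = (1 - t) * a' 1 + t * b' 1)
    (hq : dotAt q a a' ≤ 0) (hq's : dotAt q' b' b ≤ 0)
    (hq'b'a : 0 < dotAt q' b' a) (hq'b'a' : 0 < dotAt q' b' a') (hqbb' : 0 < dotAt q b b')
    (hpos : 0 < crossAt q a a') (sab : 0 < crossAt q a b) (sab' : 0 < crossAt q a b')
    (sba' : 0 < crossAt q b a') (sb'a' : 0 < crossAt q b' a')
    (hb'b : 0 < crossAt q' b' b) (uab : 0 < crossAt q' a b) (ua'b : 0 < crossAt q' a' b)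
    (ub'a : 0 < crossAt q' b' a) (ub'a' : 0 < crossAt q' b' a') : False := by
  have relA : ∀ p : Pt, s * crossAt p a b = (1 - t) * crossAt p a a' + t * crossAt p a b' := by
    intro p; unfold crossAt
    linear_combination (a 0 - p 0) * h1 - (a 1 - p 1) * h0
  have relB : ∀ p : Pt,
      (1 - s) * crossAt p b a = (1 - t) * crossAt p b a' + t * crossAt p b b' := by
    intro p; unfold crossAt
    linear_combination (b 0 - p 0) * h1 - (b 1 - p 1) * h0
  have relA' : ∀ p : Pt,
      (1 - s) * crossAt p a' a + s * crossAt p a' b = t * crossAt p a' b' := by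
    intro p; unfold crossAt
    linear_combination (a' 0 - p 0) * h1 - (a' 1 - p 1) * h0
  have relB' : ∀ p : Pt,
      (1 - s) * crossAt p b' a + s * crossAt p b' b = (1 - t) * crossAt p b' a' := by
    intro p; unfold crossAt
    linear_combination (b' 0 - p 0) * h1 - (b' 1 - p 1) * h0
  have shift : ∀ u v : Pt,
      crossAt q' u v = crossAt q u v + crossAt q q' u - crossAt q q' v := by
    intro u v; unfold crossAt; ring
  have hq'aa' : 0 < dotAt q' a a' :=
    dotAt_pos_of_crossAt hq'b'a hq'b'a' (mul_pos ub'a ub'a')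
  have t1 : 0 < 1 - t := by
    rcases eq_or_lt_of_le ht1 with h | h
    · have := relB' q'
      subst h
      rcases eq_or_lt_of_le hs with hs0 | hs0
      · subst hs0
        linarith
      · have := mul_nonneg (sub_nonneg.2 hs1) ub'a.le
        have := mul_pos hs0 hb'b
        linarith
    · linarith
  have s1 : 0 < 1 - s := by
    have := relB q'
    rw [crossAt_swap q' b a, crossAt_swap q' b a', crossAt_swap q' b b'] at this
    have := mul_pos t1 ua'b
    have := mul_nonneg ht hb'b.le
    exact pos_of_mul_pos_left (b := crossAt q' a b) (by linarith) uab.le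
  have s0 : 0 < s := by
    have := relA q
    have := mul_pos t1 hpos
    have := mul_nonneg ht sab'.le
    exact pos_of_mul_pos_left (b := crossAt q a b) (by linarith) sab.le
  have t0 : 0 < t := by
    have := relA' q
    rw [crossAt_swap q a' a, crossAt_swap q a' b, crossAt_swap q a' b'] at this
    have := mul_pos s1 hpos
    have := mul_pos s0 sba'
    exact pos_of_mul_pos_left (b := crossAt q b' a') (by linarith) sb'a'.le
  have vaa' : 0 < crossAt q' a a' := by
    have := relA q'
    rw [crossAt_swap q' a b'] at this
    have := mul_pos s0 uab
    have := mul_pos t0 ub'a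
    exact pos_of_mul_pos_right (a := 1 - t) (by linarith) t1.le
  have vb'b : 0 < crossAt q b' b := by
    have := relB q
    rw [crossAt_swap q b a, crossAt_swap q b b'] at this
    have := mul_pos t1 sba'
    have := mul_pos s1 sab
    exact pos_of_mul_pos_right (a := t) (by linarith) t0.le
  have o1 : crossAt q q' a < crossAt q q' b' := by
    have := shift b' a
    rw [crossAt_swap q b' a] at this
    linarith
  have o2 : crossAt q q' b < crossAt q q' a' := by
    have := shift a' b
    rw [crossAt_swap q a' b] at this
    linarith
  have n1 : crossAt q q' a ≤ 0 → 0 ≤ crossAt q q' a' → False := by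
    intro x y
    refine not_mem_triangle hq hq'aa' hpos vaa'.le ?_ y
    rw [crossAt_swap]; linarith
  have n2 : 0 ≤ crossAt q q' b' → crossAt q q' b ≤ 0 → False := by
    intro x y
    refine not_mem_triangle hq's (by rwa [dotAt_comm]) hb'b vb'b.le ?_ ?_
    · have : crossAt q' b' q = crossAt q q' b' := by unfold crossAt; ring
      rwa [this]
    · have : crossAt q' q b = - crossAt q q' b := by unfold crossAt; ring
      rw [this]; linarith
  have eX : (1 - s) * crossAt q q' a + s * crossAt q q' b
      = (1 - t) * crossAt q q' a' + t * crossAt q q' b' := by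
    unfold crossAt
    linear_combination (q' 0 - q 0) * h1 - (q' 1 - q 1) * h0
  have pl1 : ∀ p, (p = q ∨ p = q') →
      ((1 - s) * crossAt q q' a + s * crossAt q q' b) * crossAt p b' a
        = crossAt q q' a * ((1 - t) * crossAt p b' a')
          - crossAt q q' b' * (s * crossAt p a b) := by
    intro p hp
    rw [← relB' p]
    rcases hp with rfl | rfl <;> · unfold crossAt; ring
  have pl2 : ∀ p, (p = q ∨ p = q') →
      ((1 - s) * crossAt q q' a + s * crossAt q q' b) * crossAt p a' b
        = crossAt q q' a' * ((1 - s) * crossAt p a b)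
          - crossAt q q' b * (t * crossAt p b' a') := by
    intro p hp
    have : t * crossAt p b' a' = - ((1 - s) * crossAt p a' a + s * crossAt p a' b) := by
      rw [relA' p, crossAt_swap p b' a']; ring
    rw [this]
    rcases hp with rfl | rfl <;> · unfold crossAt; ring
  have pl1q := pl1 q (Or.inl rfl)
  have pl1q' := pl1 q' (Or.inr rfl)
  have pl2q := pl2 q (Or.inl rfl)
  have pl2q' := pl2 q' (Or.inr rfl)
  rw [crossAt_swap q b' a] at pl1q
  rw [crossAt_swap q a' b] at pl2q
  have fin : (0 < crossAt q q' a ∧ 0 < crossAt q q' a' ∧ 0 < crossAt q q' b ∧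
      0 < crossAt q q' b') ∨ (crossAt q q' a < 0 ∧ crossAt q q' a' < 0 ∧
      crossAt q q' b < 0 ∧ crossAt q q' b' < 0) := by
    rcases lt_or_ge 0 (crossAt q q' a) with x | x
    · have y : 0 < crossAt q q' b' := by linarith
      have z : 0 < crossAt q q' b := not_le.1 fun h => n2 y.le h
      exact Or.inl ⟨x, by linarith, z, y⟩
    · have y : crossAt q q' a' < 0 := not_le.1 fun h => n1 x h
      have z : crossAt q q' b < 0 := by linarith
      have w : crossAt q q' b' < 0 := not_le.1 fun h => n2 h z.le
      exact Or.inr ⟨by linarith, y, z, w⟩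
  rcases fin with ⟨fa, fa', fb, fb'⟩ | ⟨fa, fa', fb, fb'⟩
  · have hX : 0 < (1 - s) * crossAt q q' a + s * crossAt q q' b := by positivity
    have := mul_pos hX sab'
    have := mul_pos hX ub'a
    have := mul_pos hX sba'
    have := mul_pos hX ua'b
    exact same_side_false sab uab sb'a' ub'a' (mul_pos fb' s0) (mul_pos fa t1)
      (mul_pos fa' s1) (mul_pos fb t0) (by linarith) (by linarith) (by linarith) (by linarith)
  · have hX : (1 - s) * crossAt q q' a + s * crossAt q q' b < 0 := by
      have := mul_neg_of_pos_of_neg s1 fa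
      have := mul_neg_of_pos_of_neg s0 fb
      linarith
    have := mul_neg_of_neg_of_pos hX sab'
    have := mul_neg_of_neg_of_pos hX ub'a
    have := mul_neg_of_neg_of_pos hX sba'
    have := mul_neg_of_neg_of_pos hX ua'b
    exact same_side_false sab uab sb'a' ub'a' (mul_pos (neg_pos.2 fb') s0)
      (mul_pos (neg_pos.2 fa) t1) (mul_pos (neg_pos.2 fa') s1) (mul_pos (neg_pos.2 fb) t0)
      (by linarith) (by linarith) (by linarith) (by linarith)

/-- The oriented form of the crossing lemma. -/
theorem crossing_false_of_pos {a b a' b' q q' r : Pt} {s t : ℝ}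
    (hs : 0 ≤ s) (hs1 : s ≤ 1) (ht : 0 ≤ t) (ht1 : t ≤ 1)
    (h0 : (1 - s) * a 0 + s * b 0 = (1 - t) * a' 0 + t * b' 0)
    (h1 : (1 - s) * a 1 + s * b 1 = (1 - t) * a' 1 + t * b' 1)
    (hq : dotAt q a a' ≤ 0) (hq' : dotAt q' b b' ≤ 0)
    (hqab : 0 < dotAt q a b) (hqab' : 0 < dotAt q a b')
    (hqa'b : 0 < dotAt q a' b) (hqa'b' : 0 < dotAt q a' b')
    (hq'ab : 0 < dotAt q' a b) (hq'ab' : 0 < dotAt q' a b')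
    (hq'a'b : 0 < dotAt q' a' b) (hq'a'b' : 0 < dotAt q' a' b')
    (hr : 0 < dotAt r a b)
    (ha : 0 < dotAt a q r) (ha' : 0 < dotAt a q' r)
    (hb : 0 < dotAt b q r) (hb' : 0 < dotAt b q' r)
    (hpos : 0 < crossAt q a a') : False := by
  have relB : ∀ p : Pt,
      (1 - s) * crossAt p b a = (1 - t) * crossAt p b a' + t * crossAt p b b' := by
    intro p; unfold crossAt
    linear_combination (b 0 - p 0) * h1 - (b 1 - p 1) * h0
  have sab : 0 < crossAt q a b :=
    pos_of_mul_pos_right (crossAt_mul_crossAt_pos hq hqab hqa'b) hpos.le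
  have sab' : 0 < crossAt q a b' :=
    pos_of_mul_pos_right (crossAt_mul_crossAt_pos hq hqab' hqa'b') hpos.le
  have hqs : dotAt q a' a ≤ 0 := by rwa [dotAt_comm]
  have sba' : 0 < crossAt q b a' := by
    have := crossAt_mul_crossAt_pos hqs hqa'b hqab
    rw [crossAt_swap q a' a, crossAt_swap q a' b, neg_mul_neg] at this
    exact pos_of_mul_pos_right this hpos.le
  have sb'a' : 0 < crossAt q b' a' := by
    have := crossAt_mul_crossAt_pos hqs hqa'b' hqab'
    rw [crossAt_swap q a' a, crossAt_swap q a' b', neg_mul_neg] at this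
    exact pos_of_mul_pos_right this hpos.le
  have hqbb' : 0 < dotAt q b b' := dotAt_pos_of_crossAt hqab hqab' (mul_pos sab sab')
  have hq'ba : 0 < dotAt q' b a := by rwa [dotAt_comm]
  have hq'ba' : 0 < dotAt q' b a' := by rwa [dotAt_comm]
  have hq'b'a : 0 < dotAt q' b' a := by rwa [dotAt_comm]
  have hq'b'a' : 0 < dotAt q' b' a' := by rwa [dotAt_comm]
  have hq's : dotAt q' b' b ≤ 0 := by rwa [dotAt_comm]
  have tba := crossAt_mul_crossAt_pos hq' hq'ba hq'b'a
  have tba' := crossAt_mul_crossAt_pos hq' hq'ba' hq'b'a'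
  have tb'a := crossAt_mul_crossAt_pos hq's hq'b'a hq'ba
  have tb'a' := crossAt_mul_crossAt_pos hq's hq'b'a' hq'ba'
  have hne : crossAt q' b b' ≠ 0 := by
    intro h; rw [h, zero_mul] at tba; exact lt_irrefl _ tba
  rcases lt_or_gt_of_ne hne with hneg | hgt
  · -- the lines `ab'` and `a'b` separate `q` from `q'`
    have hb'b : 0 < crossAt q' b' b := by rw [crossAt_swap]; linarith
    have uab : 0 < crossAt q' a b := by
      rw [crossAt_swap q' a b]
      have := neg_of_mul_pos_right tba hneg.le
      linarith
    have ua'b : 0 < crossAt q' a' b := by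
      rw [crossAt_swap q' a' b]
      have := neg_of_mul_pos_right tba' hneg.le
      linarith
    have ub'a := pos_of_mul_pos_right tb'a hb'b.le
    have ub'a' := pos_of_mul_pos_right tb'a' hb'b.le
    exact crossing_false_of_lines_separate hs hs1 ht ht1 h0 h1 hq hq's hq'b'a hq'b'a' hqbb' hpos
      sab sab' sba' sb'a' hb'b uab ua'b ub'a ub'a'
  · -- the lines `ab` and `a'b'` separate `q` from `q'`
    have uba := pos_of_mul_pos_right tba hgt.le
    have uba' := pos_of_mul_pos_right tba' hgt.le
    have hb'b : crossAt q' b' b < 0 := by rw [crossAt_swap]; linarith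
    have uab' : 0 < crossAt q' a b' := by
      rw [crossAt_swap]
      have := neg_of_mul_pos_right tb'a hb'b.le
      linarith
    have hd : 0 < crossAt q a b + crossAt q' b a := by positivity
    obtain ⟨τ, hτ⟩ : ∃ τ, τ * (crossAt q a b + crossAt q' b a) = crossAt q a b :=
      ⟨_, div_mul_cancel₀ _ hd.ne'⟩
    have hτ0 : 0 < τ := pos_of_mul_pos_left (lt_of_lt_of_eq sab hτ.symm) hd.le
    have hτ1 : τ < 1 := by
      by_contra h
      have := mul_nonneg (sub_nonneg.2 (not_lt.1 h)) hd.le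
      linarith only [this, hτ, uba]
    obtain ⟨x, hx⟩ : ∃ x : Pt, x = !₂[q 0 + τ * (q' 0 - q 0), q 1 + τ * (q' 1 - q 1)] := ⟨_, rfl⟩
    have hx0 : x 0 = q 0 + τ * (q' 0 - q 0) := by simp [hx]
    have hx1 : x 1 = q 1 + τ * (q' 1 - q 1) := by simp [hx]
    have aff : ∀ u v : Pt, crossAt x u v = (1 - τ) * crossAt q u v + τ * crossAt q' u v := by
      intro u v; unfold crossAt; rw [hx0, hx1]; ring
    have xab : crossAt x a b = 0 := by
      rw [aff, crossAt_swap q' a b]; linear_combination -hτ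
    have hτ1' := sub_pos.2 hτ1
    have xab' : 0 < crossAt x a b' := by rw [aff]; positivity
    have xba' : 0 < crossAt x b a' := by rw [aff]; positivity
    have xbb' : crossAt x b b' ≤ 0 := by
      have h := relB x
      rw [crossAt_swap x b a, xab, neg_zero, mul_zero] at h
      rcases eq_or_lt_of_le ht with h' | h'
      · subst h'; linarith
      · have := mul_nonneg (sub_nonneg.2 ht1) xba'.le
        by_contra hcon
        have := mul_pos h' (not_le.1 hcon)
        linarith
    have hne : 0 < dotAt a b b := by
      refine dotAt_self_pos ?_
      rintro rfl
      unfold crossAt at sab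
      linarith
    obtain ⟨ρ, e0, e1⟩ := exists_lineMap_of_crossAt_eq_zero hne xab
    have c1 : crossAt x a b' = -ρ * crossAt a b b' := by
      unfold crossAt; rw [e0, e1]; ring
    have c2 : crossAt x b b' = (1 - ρ) * crossAt a b b' := by
      unfold crossAt; rw [e0, e1]; ring
    have c3 : crossAt a b b' < 0 := by linarith only [c1, c2, xab', xbb']
    have hρ0 : 0 ≤ ρ := by
      by_contra h
      have := mul_pos_of_neg_of_neg (not_le.1 h) c3
      linarith only [this, c1, xab']
    have hρ1 : ρ ≤ 1 := by
      by_contra h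
      have := mul_pos_of_neg_of_neg (sub_neg.2 (not_le.1 h)) c3
      linarith only [this, c2, xbb']
    exact edge_not_meet_segment hτ0.le hτ1.le hρ0 hρ1 (by rw [← hx0, e0]) (by rw [← hx1, e1])
      hqab hq'ab hr ha ha' hb hb'

/-- A drawing that is witnessed by `q`, `q'` and a common neighbour `r` of theirs has no crossing
edges `ab`, `a'b'`. -/
theorem crossing_false {a b a' b' q q' r : Pt} {s t : ℝ}
    (hs : 0 ≤ s) (hs1 : s ≤ 1) (ht : 0 ≤ t) (ht1 : t ≤ 1)
    (h0 : (1 - s) * a 0 + s * b 0 = (1 - t) * a' 0 + t * b' 0)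
    (h1 : (1 - s) * a 1 + s * b 1 = (1 - t) * a' 1 + t * b' 1)
    (hq : dotAt q a a' ≤ 0) (hq' : dotAt q' b b' ≤ 0) {Q P : Set Pt}
    (hqQ : q ∈ Q) (hq'Q : q' ∈ Q) (hrQ : r ∈ Q)
    (haP : a ∈ P) (ha'P : a' ∈ P) (hbP : b ∈ P) (hb'P : b' ∈ P)
    (hab : ∀ w ∈ Q, 0 < dotAt w a b) (hab' : ∀ w ∈ Q, 0 < dotAt w a b')
    (ha'b : ∀ w ∈ Q, 0 < dotAt w a' b) (ha'b' : ∀ w ∈ Q, 0 < dotAt w a' b')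
    (hqr : ∀ p ∈ P, 0 < dotAt p q r) (hq'r : ∀ p ∈ P, 0 < dotAt p q' r) : False := by
  have hne : crossAt q a a' ≠ 0 := by
    intro h
    have := crossAt_mul_crossAt_pos hq (hab q hqQ) (ha'b q hqQ)
    rw [h, zero_mul] at this
    exact lt_irrefl _ this
  rcases lt_or_gt_of_ne hne with hneg | hpos
  · refine crossing_false_of_pos (a := a') (b := b') (a' := a) (b' := b) ht ht1 hs hs1 h0.symm
      h1.symm (by rwa [dotAt_comm]) (by rwa [dotAt_comm]) (ha'b' q hqQ) (ha'b q hqQ)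
      (hab' q hqQ) (hab q hqQ) (ha'b' q' hq'Q) (ha'b q' hq'Q) (hab' q' hq'Q) (hab q' hq'Q)
      (ha'b' r hrQ) (hqr _ ha'P) (hq'r _ ha'P) (hqr _ hb'P) (hq'r _ hb'P) ?_
    rw [crossAt_swap]; linarith
  · exact crossing_false_of_pos hs hs1 ht ht1 h0 h1 hq hq' (hab q hqQ) (hab' q hqQ)
      (ha'b q hqQ) (ha'b' q hqQ) (hab q' hq'Q) (hab' q' hq'Q) (ha'b q' hq'Q) (ha'b' q' hq'Q)
      (hab r hrQ) (hqr _ haP) (hq'r _ haP) (hqr _ hbP) (hq'r _ hbP) hpos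

theorem gabrielDisk_inter_eq_empty_iff (u v : Pt) (Q : Set Pt) :
    gabrielDisk u v ∩ Q = ∅ ↔ ∀ w ∈ Q, 0 < dotAt w u v := by
  rw [Set.eq_empty_iff_forall_notMem]
  simp only [Set.mem_inter_iff, mem_gabrielDisk_iff, not_and']
  simp only [not_le]

theorem IsMWGDrawing.symm {V₀ V₁ : Type*} [Fintype V₀] [Fintype V₁] {G₀ : SimpleGraph V₀}
    {G₁ : SimpleGraph V₁} {f₀ : V₀ → Pt} {f₁ : V₁ → Pt} (h : IsMWGDrawing G₀ G₁ f₀ f₁) :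
    IsMWGDrawing G₁ G₀ f₁ f₀ :=
  ⟨h.2.1, h.1, h.2.2.1.symm, h.2.2.2.2, h.2.2.2.1⟩

/-- Two edges of the first drawing with equally coloured starting points do not cross. -/
theorem IsMWGDrawing.disjoint_segment_of_color_eq {V₀ V₁ : Type*} [Fintype V₀] [Fintype V₁]
    {G₀ : SimpleGraph V₀} {G₁ : SimpleGraph V₁} {c₀ : V₀ → Bool} {c₁ : V₁ → Bool}
    (hbip₀ : ∀ u v : V₀, u ≠ v → (G₀.Adj u v ↔ c₀ u ≠ c₀ v))
    (hbip₁ : ∀ u v : V₁, u ≠ v → (G₁.Adj u v ↔ c₁ u ≠ c₁ v))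
    (hcl₁t : ∃ v, c₁ v = true) (hcl₁f : ∃ v, c₁ v = false)
    {f₀ : V₀ → Pt} {f₁ : V₁ → Pt} (hMWG : IsMWGDrawing G₀ G₁ f₀ f₁)
    {a b a' b' : V₀} (haa' : a ≠ a') (hbb' : b ≠ b')
    (hab : c₀ a ≠ c₀ b) (hca : c₀ a = c₀ a') (hcb : c₀ b = c₀ b') :
    Disjoint (segment ℝ (f₀ a) (f₀ b)) (segment ℝ (f₀ a') (f₀ b')) := by
  obtain ⟨-, -, hdisj, hd₀, hd₁⟩ := hMWG
  have edge₀ : ∀ u v : V₀, c₀ u ≠ c₀ v → ∀ w ∈ Set.range f₁, 0 < dotAt w (f₀ u) (f₀ v) := by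
    intro u v huv
    have hne : u ≠ v := fun h => huv (h ▸ rfl)
    exact (gabrielDisk_inter_eq_empty_iff _ _ _).1 ((hd₀ u v hne).1 ((hbip₀ u v hne).2 huv))
  have edge₁ : ∀ u v : V₁, c₁ u ≠ c₁ v → ∀ w ∈ Set.range f₀, 0 < dotAt w (f₁ u) (f₁ v) := by
    intro u v huv
    have hne : u ≠ v := fun h => huv (h ▸ rfl)
    exact (gabrielDisk_inter_eq_empty_iff _ _ _).1 ((hd₁ u v hne).1 ((hbip₁ u v hne).2 huv))
  have nonedge₀ : ∀ u v : V₀, u ≠ v → c₀ u = c₀ v → ∃ j, dotAt (f₁ j) (f₀ u) (f₀ v) ≤ 0 := by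
    intro u v hne huv
    by_contra! hcon
    refine (hbip₀ u v hne).1 ((hd₀ u v hne).2 ?_) huv
    rw [gabrielDisk_inter_eq_empty_iff]
    rintro _ ⟨j, rfl⟩
    exact hcon j
  obtain ⟨j, hj⟩ := nonedge₀ a a' haa' hca
  obtain ⟨j', hj'⟩ := nonedge₀ b b' hbb' hcb
  obtain ⟨k, hk, hk'⟩ : ∃ k, (∀ p ∈ Set.range f₀, 0 < dotAt p (f₁ j) (f₁ k)) ∧
      ∀ p ∈ Set.range f₀, 0 < dotAt p (f₁ j') (f₁ k) := by
    by_cases hc : c₁ j = c₁ j'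
    · obtain ⟨k, hk⟩ : ∃ k, c₁ j ≠ c₁ k := by
        obtain ⟨x, hx⟩ := hcl₁t
        obtain ⟨y, hy⟩ := hcl₁f
        cases h : c₁ j
        · exact ⟨x, by simp [hx]⟩
        · exact ⟨y, by simp [hy]⟩
      exact ⟨k, edge₁ j k hk, edge₁ j' k (hc ▸ hk)⟩
    · refine ⟨j', edge₁ j j' hc, fun p hp => dotAt_self_pos ?_⟩
      rintro rfl
      exact Set.disjoint_left.1 hdisj hp ⟨j', rfl⟩
  rw [Set.disjoint_left]
  rintro x ⟨s', s, hs', hs, hss, hx⟩ ⟨t', t, ht', ht, htt, hx'⟩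
  obtain rfl : s' = 1 - s := by linarith
  obtain rfl : t' = 1 - t := by linarith
  have e : ∀ i, (1 - s) * f₀ a i + s * f₀ b i = (1 - t) * f₀ a' i + t * f₀ b' i := by
    intro i
    have := congrArg (fun z : Pt => z i) (hx.trans hx'.symm)
    simpa using this
  exact crossing_false hs (by linarith) ht (by linarith) (e 0) (e 1) hj hj'
    (Set.mem_range_self j) (Set.mem_range_self j') (Set.mem_range_self k)
    (Set.mem_range_self a) (Set.mem_range_self a') (Set.mem_range_self b)
    (Set.mem_range_self b') (edge₀ a b hab) (edge₀ a b' (hcb ▸ hab)) (edge₀ a' b (hca ▸ hab))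
    (edge₀ a' b' (hca ▸ hcb ▸ hab)) hk hk'

/-- The first drawing of a mutual witness Gabriel drawing of complete bipartite graphs is
crossing-free. -/
theorem IsMWGDrawing.disjoint_segment {V₀ V₁ : Type*} [Fintype V₀] [Fintype V₁]
    {G₀ : SimpleGraph V₀} {G₁ : SimpleGraph V₁} {c₀ : V₀ → Bool} {c₁ : V₁ → Bool}
    (hbip₀ : ∀ u v : V₀, u ≠ v → (G₀.Adj u v ↔ c₀ u ≠ c₀ v))
    (hbip₁ : ∀ u v : V₁, u ≠ v → (G₁.Adj u v ↔ c₁ u ≠ c₁ v))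
    (hcl₁t : ∃ v, c₁ v = true) (hcl₁f : ∃ v, c₁ v = false)
    {f₀ : V₀ → Pt} {f₁ : V₁ → Pt} (hMWG : IsMWGDrawing G₀ G₁ f₀ f₁)
    {a b a' b' : V₀} (hab : a ≠ b) (haa' : a ≠ a') (hab' : a ≠ b') (hba' : b ≠ a')
    (hbb' : b ≠ b') (ha'b' : a' ≠ b') (h : G₀.Adj a b) (h' : G₀.Adj a' b') :
    Disjoint (segment ℝ (f₀ a) (f₀ b)) (segment ℝ (f₀ a') (f₀ b')) := by
  have hc := (hbip₀ a b hab).1 h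
  have hc' := (hbip₀ a' b' ha'b').1 h'
  by_cases hca : c₀ a = c₀ a'
  · refine hMWG.disjoint_segment_of_color_eq hbip₀ hbip₁ hcl₁t hcl₁f haa' hbb' hc hca ?_
    revert hc hc' hca
    cases c₀ a <;> cases c₀ b <;> cases c₀ a' <;> cases c₀ b' <;> simp
  · rw [segment_symm ℝ (f₀ a') (f₀ b')]
    refine hMWG.disjoint_segment_of_color_eq hbip₀ hbip₁ hcl₁t hcl₁f hab' hba' hc ?_ ?_ <;>
    · revert hc hc' hca
      cases c₀ a <;> cases c₀ b <;> cases c₀ a' <;> cases c₀ b' <;> simp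

/-- Corollary 1: in an MWG-drawing of a pair of complete bipartite graphs, each of the
two drawings is crossing-free. -/
theorem stmt6 {V₀ V₁ : Type*} [Fintype V₀] [Fintype V₁]
    (G₀ : SimpleGraph V₀) (G₁ : SimpleGraph V₁) (c₀ : V₀ → Bool) (c₁ : V₁ → Bool)
    (hbip₀ : ∀ u v : V₀, u ≠ v → (G₀.Adj u v ↔ c₀ u ≠ c₀ v))
    (hbip₁ : ∀ u v : V₁, u ≠ v → (G₁.Adj u v ↔ c₁ u ≠ c₁ v))
    (hcl₀t : ∃ v, c₀ v = true) (hcl₀f : ∃ v, c₀ v = false)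
    (hcl₁t : ∃ v, c₁ v = true) (hcl₁f : ∃ v, c₁ v = false)
    (hnc₀ : ∃ u v : V₀, u ≠ v ∧ ¬ G₀.Adj u v)
    (hnc₁ : ∃ u v : V₁, u ≠ v ∧ ¬ G₁.Adj u v)
    (f₀ : V₀ → Pt) (f₁ : V₁ → Pt) (hMWG : IsMWGDrawing G₀ G₁ f₀ f₁) :
    (∀ a b a' b' : V₀, a ≠ b → a ≠ a' → a ≠ b' → b ≠ a' → b ≠ b' → a' ≠ b' →
      G₀.Adj a b → G₀.Adj a' b' →
      Disjoint (segment ℝ (f₀ a) (f₀ b)) (segment ℝ (f₀ a') (f₀ b'))) ∧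
    (∀ a b a' b' : V₁, a ≠ b → a ≠ a' → a ≠ b' → b ≠ a' → b ≠ b' → a' ≠ b' →
      G₁.Adj a b → G₁.Adj a' b' →
      Disjoint (segment ℝ (f₁ a) (f₁ b)) (segment ℝ (f₁ a') (f₁ b'))) := by
  exact ⟨fun _ _ _ _ h1 h2 h3 h4 h5 h6 h7 h8 =>
      hMWG.disjoint_segment hbip₀ hbip₁ hcl₁t hcl₁f h1 h2 h3 h4 h5 h6 h7 h8,
    fun _ _ _ _ h1 h2 h3 h4 h5 h6 h7 h8 =>
      hMWG.symm.disjoint_segment hbip₁ hbip₀ hcl₀t hcl₀f h1 h2 h3 h4 h5 h6 h7 h8⟩
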